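/- arXiv:1605.06254 — 3 statements merged into one kernel-verified Lean document; each statement's English description precedes it below -/
import Mathlib

section
/- Let p : ℝ → ℝ be a 2π-periodic function of class C² with p(φ) + p''(φ) > 0 for all φ, satisfying ∫₀^{2π} p(φ)cos φ dφ = 0 and ∫₀^{2π} p(φ)sin φ dφ = 0. Set L = ∫₀^{2π} p dφ, F = ½∫₀^{2π}(p² − p'²) dφ, A = ½∫₀^{2π} p² dφ and Δ = L² − 4πF. Then Δ = 3π(A − F) if and only if there exist constants a₀, a₂, b₂ such that p(φ) = a₀ + a₂cos(2φ) + b₂sin(2φ) for all φ (i.e., the curve is a circle or a curve parallel to an astroid). -/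
open Real

lemma aux_coeff (f : ℝ → ℂ) (n : ℤ) :
    fourierCoeffOn (by linarith [Real.pi_pos] : (0:ℝ) < 2 * π) f n
      = (1 / (2 * π) : ℝ) • ∫ x in (0:ℝ)..(2 * π), Complex.exp (-(n * x * Complex.I)) * f x := by
  rw [fourierCoeffOn_eq_integral]
  simp only [sub_zero]
  congr 1
  apply intervalIntegral.integral_congr
  intro x _
  have : @fourier (2 * π - 0) (-n) (x : AddCircle (2 * π - 0))
      = Complex.exp (-(n * x * Complex.I)) := by
    rw [fourier_coe_apply]
    congr 1
    have := Complex.ofReal_ne_zero.2 Real.pi_ne_zero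
    push_cast
    field_simp
    simp
    ring
  simp only [smul_eq_mul]
  rw [← this]

lemma aux_one (p : ℝ → ℝ) (hc : Continuous p) (n : ℤ) (hn : n = 1 ∨ n = -1)
    (hcos : ∫ φ in (0:ℝ)..(2 * π), p φ * Real.cos φ = 0)
    (hsin : ∫ φ in (0:ℝ)..(2 * π), p φ * Real.sin φ = 0) :
    fourierCoeffOn (by linarith [Real.pi_pos] : (0:ℝ) < 2 * π) (fun x => (p x : ℂ)) n = 0 := by
  rw [aux_coeff]
  have : ∀ x : ℝ, Complex.exp (-(n * x * Complex.I)) * (p x : ℂ)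
      = ((p x * Real.cos x : ℝ) : ℂ) + (-n * Complex.I) * ((p x * Real.sin x : ℝ) : ℂ) := by
    intro x
    rcases hn with rfl | rfl
    · have : -(((1:ℤ):ℂ) * x * Complex.I) = ((-x : ℝ) : ℂ) * Complex.I := by push_cast; ring
      rw [this, Complex.exp_mul_I, ← Complex.ofReal_cos, ← Complex.ofReal_sin]
      simp; ring
    · have : -(((-1:ℤ):ℂ) * x * Complex.I) = ((x : ℝ) : ℂ) * Complex.I := by push_cast; ring
      rw [this, Complex.exp_mul_I, ← Complex.ofReal_cos, ← Complex.ofReal_sin]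
      simp; ring
  simp_rw [this]
  rw [intervalIntegral.integral_add, intervalIntegral.integral_const_mul,
    intervalIntegral.integral_ofReal, intervalIntegral.integral_ofReal, hcos, hsin]
  · simp
  · apply Continuous.intervalIntegrable; fun_prop
  · apply Continuous.intervalIntegrable; fun_prop

lemma aux_zero (p : ℝ → ℝ) :
    fourierCoeffOn (by linarith [Real.pi_pos] : (0:ℝ) < 2 * π) (fun x => (p x : ℂ)) 0
      = (((1 / (2 * π)) * ∫ φ in (0:ℝ)..(2 * π), p φ : ℝ) : ℂ) := by
  rw [aux_coeff]
  simp [intervalIntegral.integral_ofReal]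

lemma aux_parseval (p : ℝ → ℝ) (hc : Continuous p) :
    HasSum (fun n : ℤ => ‖fourierCoeffOn (by linarith [Real.pi_pos] : (0:ℝ) < 2 * π)
      (fun x => (p x : ℂ)) n‖ ^ 2) ((2 * π)⁻¹ * ∫ φ in (0:ℝ)..(2 * π), p φ ^ 2) := by
  have h := hasSum_sq_fourierCoeffOn (f := fun x => (p x : ℂ))
    (by linarith [Real.pi_pos] : (0:ℝ) < 2 * π) (by
      have hc' : Continuous (fun x => (p x : ℂ)) := by fun_prop
      obtain ⟨C, hC⟩ := (isCompact_Icc (a := (0:ℝ)) (b := 2 * π)).exists_bound_of_continuousOn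
        hc'.continuousOn
      refine MeasureTheory.MemLp.of_bound hc'.aestronglyMeasurable C ?_
      filter_upwards [MeasureTheory.ae_restrict_mem measurableSet_Ioc] with x hx
      exact hC x (Set.Ioc_subset_Icc_self hx))
  simpa using h

lemma aux_deriv (p : ℝ → ℝ) (hper : Function.Periodic p (2 * π)) (hC2 : ContDiff ℝ 2 p) (n : ℤ) :
    ‖fourierCoeffOn (by linarith [Real.pi_pos] : (0:ℝ) < 2 * π)
      (fun x => ((deriv p x : ℝ) : ℂ)) n‖ ^ 2 = (n:ℝ) ^ 2 *
    ‖fourierCoeffOn (by linarith [Real.pi_pos] : (0:ℝ) < 2 * π) (fun x => (p x : ℂ)) n‖ ^ 2 := by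
  have hd : ∀ x, HasDerivAt p (deriv p x) x := fun x =>
    ((hC2.differentiable (by norm_num)) x).hasDerivAt
  have hdc : Continuous (deriv p) := hC2.continuous_deriv (by norm_num)
  have h0 : p (2 * π) = p 0 := by simpa using hper 0
  by_cases hn : n = 0
  · subst hn
    rw [aux_zero, intervalIntegral.integral_eq_sub_of_hasDerivAt (fun x _ => hd x)
      (hdc.intervalIntegrable _ _)]
    simp [h0]
  · rw [fourierCoeffOn_of_hasDerivAt (f := fun x => (p x : ℂ))
      (f' := fun x => ((deriv p x : ℝ) : ℂ)) _ hn (fun x _ => (hd x).ofReal_comp)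
      (by apply Continuous.intervalIntegrable; fun_prop)]
    have hnr : (n:ℝ) ≠ 0 := by exact_mod_cast hn
    have hpi := Real.pi_pos
    simp only [h0, sub_self, mul_zero, zero_sub, Complex.ofReal_zero, sub_zero]
    simp only [norm_mul, norm_neg, norm_div, norm_one, Complex.norm_I, Complex.norm_real,
      Complex.norm_intCast, Real.norm_eq_abs]
    simp only [mul_pow, div_pow, sq_abs, abs_of_pos hpi]
    simp
    field_simp

lemma aux_forward (p : ℝ → ℝ) (hper : Function.Periodic p (2 * π)) (hC2 : ContDiff ℝ 2 p)
    (hcos : ∫ φ in (0:ℝ)..(2 * π), p φ * Real.cos φ = 0)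
    (hsin : ∫ φ in (0:ℝ)..(2 * π), p φ * Real.sin φ = 0)
    (h : (∫ φ in (0:ℝ)..(2 * π), deriv p φ ^ 2) - 4 * (∫ φ in (0:ℝ)..(2 * π), p φ ^ 2)
      + 2 / π * (∫ φ in (0:ℝ)..(2 * π), p φ) ^ 2 = 0) :
    ∃ a₀ a₂ b₂ : ℝ, ∀ φ : ℝ,
        p φ = a₀ + a₂ * Real.cos (2 * φ) + b₂ * Real.sin (2 * φ) := by
  have hpi := Real.pi_pos
  have hab : (0:ℝ) < 2 * π := by linarith
  have hdc : Continuous (deriv p) := hC2.continuous_deriv (by norm_num)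
  have hc : Continuous p := hC2.continuous
  set c : ℤ → ℂ := fun n => fourierCoeffOn hab (fun x => (p x : ℂ)) n with hcdef
  have s1 : HasSum (fun n => ‖c n‖ ^ 2) _ := aux_parseval p hc
  have s2 := aux_parseval (deriv p) hdc
  simp_rw [aux_deriv p hper hC2] at s2
  have s3 := (s2.sub (s1.mul_left 4)).add (hasSum_ite_eq (0:ℤ) (4 * ‖c 0‖ ^ 2))
  have c0 : ‖c 0‖ ^ 2 = ((1 / (2 * π)) * ∫ φ in (0:ℝ)..(2 * π), p φ) ^ 2 := by
    rw [hcdef]; simp only [aux_zero]; rw [Complex.norm_real, Real.norm_eq_abs, sq_abs]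
  have hz : (2 * π)⁻¹ * (∫ φ in (0:ℝ)..(2 * π), deriv p φ ^ 2)
      - 4 * ((2 * π)⁻¹ * ∫ φ in (0:ℝ)..(2 * π), p φ ^ 2) + 4 * ‖c 0‖ ^ 2 = 0 := by
    rw [c0]
    have : (2 * π)⁻¹ * ((∫ φ in (0:ℝ)..(2 * π), deriv p φ ^ 2)
      - 4 * (∫ φ in (0:ℝ)..(2 * π), p φ ^ 2)
      + 2 / π * (∫ φ in (0:ℝ)..(2 * π), p φ) ^ 2) = 0 := by rw [h, mul_zero]
    refine Eq.trans ?_ this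
    field_simp
    ring
  rw [hz] at s3
  have c1 : c 1 = 0 := aux_one p hc 1 (Or.inl rfl) hcos hsin
  have c2 : c (-1) = 0 := aux_one p hc (-1) (Or.inr rfl) hcos hsin
  have big : ∀ n : ℤ, n ≠ 0 → n ≠ 1 → n ≠ -1 → (4:ℝ) ≤ (n:ℝ) ^ 2 := by
    intro n h0 h1 h2
    have : 2 ≤ n ∨ n ≤ -2 := by omega
    have : 4 ≤ n ^ 2 := by rcases this with h | h <;> nlinarith
    exact_mod_cast this
  have hall := (hasSum_zero_iff_of_nonneg (by
    intro n
    change 0 ≤ (n:ℝ) ^ 2 * ‖c n‖ ^ 2 - 4 * ‖c n‖ ^ 2 + (if n = 0 then 4 * ‖c 0‖ ^ 2 else 0)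
    by_cases h0 : n = 0
    · subst h0; simp [hcdef]
    by_cases h1 : n = 1
    · subst h1; simp [hcdef] at c1; simp [hcdef, c1]
    by_cases h2 : n = -1
    · subst h2; simp [hcdef] at c2; simp [hcdef, c2]
    have := big n h0 h1 h2
    simp only [h0, if_false, add_zero]
    change 0 ≤ (n:ℝ) ^ 2 * ‖c n‖ ^ 2 - 4 * ‖c n‖ ^ 2
    nlinarith [sq_nonneg ‖c n‖])).1 s3
  have hvan : ∀ n : ℤ, n ∉ ({-2, 0, 2} : Finset ℤ) → c n = 0 := by
    intro n hn
    simp only [Finset.mem_insert, Finset.mem_singleton, not_or] at hn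
    obtain ⟨g1, h0, g2⟩ := hn
    by_cases h1 : n = 1
    · rw [h1]; exact c1
    by_cases h2 : n = -1
    · rw [h2]; exact c2
    have hb : (9:ℝ) ≤ (n:ℝ) ^ 2 := by
      have : 3 ≤ n ∨ n ≤ -3 := by omega
      have : 9 ≤ n ^ 2 := by rcases this with h | h <;> nlinarith
      exact_mod_cast this
    have := congrFun hall n
    simp only [h0, if_false, add_zero, Pi.zero_apply] at this
    change (n:ℝ) ^ 2 * ‖c n‖ ^ 2 - 4 * ‖c n‖ ^ 2 = 0 at this
    have : ‖c n‖ ^ 2 = 0 := by nlinarith [sq_nonneg ‖c n‖]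
    simpa using this
  have : Fact (0 < 2 * π) := ⟨hab⟩
  have hper' : Function.Periodic (fun x => (p x : ℂ)) (2 * π) := fun x => by simp [hper x]
  let g : C(AddCircle (2 * π), ℂ) := ⟨hper'.lift, by
    apply continuous_coinduced_dom.2
    change Continuous (fun x => (p x : ℂ))
    fun_prop⟩
  have hg : ∀ x : ℝ, g (x : AddCircle (2 * π)) = p x := fun x => rfl
  have hgc : ∀ n, fourierCoeff g n = c n := by
    intro n
    rw [fourierCoeff_eq_intervalIntegral _ _ 0, hcdef]
    simp only [aux_coeff, zero_add]
    congr 1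
    apply intervalIntegral.integral_congr
    intro x _
    simp only [hg, smul_eq_mul]
    rw [fourier_coe_apply]
    congr 2
    have := Complex.ofReal_ne_zero.2 Real.pi_ne_zero
    push_cast
    field_simp
  have hsum : Summable (fourierCoeff g) :=
    summable_of_ne_finset_zero (s := {-2, 0, 2}) (fun n hn => by rw [hgc]; exact hvan n hn)
  refine ⟨(c 0).re, (c (-2)).re + (c 2).re, (c (-2)).im - (c 2).im, fun x => ?_⟩
  have hx := has_pointwise_sum_fourier_series_of_summable hsum (x : AddCircle (2 * π))
  have hy := hx.unique (hasSum_sum_of_ne_finset_zero (s := {-2, 0, 2})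
    (fun n hn => by rw [hgc, hvan n hn, zero_smul]))
  rw [hg] at hy
  have e : ∀ n : ℤ, @fourier (2 * π) n (x : AddCircle (2 * π))
      = Complex.exp ((n * x : ℝ) * Complex.I) := by
    intro n
    rw [fourier_coe_apply]
    congr 1
    have := Complex.ofReal_ne_zero.2 Real.pi_ne_zero
    push_cast
    field_simp
  simp only [hgc, e] at hy
  rw [Finset.sum_insert (by decide), Finset.sum_insert (by decide), Finset.sum_singleton] at hy
  have hr := congrArg Complex.re hy
  simp only [Complex.ofReal_re, Complex.add_re, smul_eq_mul, Complex.mul_re,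
    Complex.exp_ofReal_mul_I_re, Complex.exp_ofReal_mul_I_im] at hr
  rw [hr]
  push_cast
  simp only [neg_mul, Real.cos_neg, Real.sin_neg, zero_mul, Real.cos_zero, Real.sin_zero]
  ring

lemma aux_backward (p : ℝ → ℝ) (a₀ a b : ℝ)
    (hp : ∀ φ : ℝ, p φ = a₀ + a * Real.cos (2 * φ) + b * Real.sin (2 * φ)) :
    (∫ φ in (0:ℝ)..(2 * π), deriv p φ ^ 2) - 4 * (∫ φ in (0:ℝ)..(2 * π), p φ ^ 2)
      + 2 / π * (∫ φ in (0:ℝ)..(2 * π), p φ) ^ 2 = 0 := by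
  have hp' : p = fun φ => a₀ + a * Real.cos (2 * φ) + b * Real.sin (2 * φ) := funext hp
  have hC : ∀ x : ℝ, HasDerivAt (fun x => Real.cos (2 * x)) (-2 * Real.sin (2 * x)) x := by
    intro x
    have := ((hasDerivAt_id x).const_mul 2).cos
    simp only [id] at this
    convert this using 1; ring
  have hS : ∀ x : ℝ, HasDerivAt (fun x => Real.sin (2 * x)) (2 * Real.cos (2 * x)) x := by
    intro x
    have := ((hasDerivAt_id x).const_mul 2).sin
    simp only [id] at this
    convert this using 1; ring
  have hd : deriv p = fun x => a * (-2 * Real.sin (2 * x)) + b * (2 * Real.cos (2 * x)) := by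
    funext x
    rw [hp']
    exact ((((hC x).const_mul a).const_add a₀).add ((hS x).const_mul b)).deriv
  have hv : ∀ x : ℝ, HasDerivAt (fun x => -a * Real.sin (2 * x) + b * Real.cos (2 * x))
      (-a * (2 * Real.cos (2 * x)) + b * (-2 * Real.sin (2 * x))) x := fun x =>
    ((hS x).const_mul (-a)).add ((hC x).const_mul b)
  have hu : ∀ x : ℝ, HasDerivAt (fun x => a * Real.cos (2 * x) + b * Real.sin (2 * x))
      (a * (-2 * Real.sin (2 * x)) + b * (2 * Real.cos (2 * x))) x := fun x =>
    ((hC x).const_mul a).add ((hS x).const_mul b)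
  have e1 : Real.cos (2 * (2 * π)) = 1 := by
    have := Real.cos_nat_mul_two_pi 2; simpa using this
  have e2 : Real.sin (2 * (2 * π)) = 0 := by
    have := Real.sin_nat_mul_pi 4; rw [← this]; congr 1; push_cast; ring
  have hcp : Continuous p := by rw [hp']; fun_prop
  have hcd : Continuous (deriv p) := by rw [hd]; fun_prop
  have hL : ∫ φ in (0:ℝ)..(2 * π), p φ = 2 * π * a₀ := by
    rw [intervalIntegral.integral_eq_sub_of_hasDerivAt
      (f := fun x => a₀ * x + (-1/2) * (-a * Real.sin (2 * x) + b * Real.cos (2 * x)))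
      (fun x _ => ?_) (hcp.intervalIntegrable _ _)]
    · simp [e1, e2]; ring
    · refine HasDerivAt.congr_deriv (((hasDerivAt_id x).const_mul a₀).add ((hv x).const_mul (-1/2))) ?_
      rw [hp]; ring
  have hE : (∫ φ in (0:ℝ)..(2 * π), deriv p φ ^ 2) - 4 * (∫ φ in (0:ℝ)..(2 * π), p φ ^ 2)
      = - 8 * π * a₀ ^ 2 := by
    rw [← intervalIntegral.integral_const_mul, ← intervalIntegral.integral_sub
      (by apply Continuous.intervalIntegrable; fun_prop)
      (by apply Continuous.intervalIntegrable; fun_prop)]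
    rw [intervalIntegral.integral_eq_sub_of_hasDerivAt
      (f := fun x => 2 * ((a * Real.cos (2 * x) + b * Real.sin (2 * x)) *
        (-a * Real.sin (2 * x) + b * Real.cos (2 * x)))
        + 4 * a₀ * (-a * Real.sin (2 * x) + b * Real.cos (2 * x)) + (-4 * a₀ ^ 2) * x)
      (fun x _ => ?_)
      (by apply Continuous.intervalIntegrable; fun_prop)]
    · simp [e1, e2]; ring
    · refine HasDerivAt.congr_deriv (((((hu x).mul (hv x)).const_mul 2).add
        ((hv x).const_mul (4 * a₀))).add ((hasDerivAt_id x).const_mul (-4 * a₀ ^ 2))) ?_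
      rw [hp, hd]; ring
  rw [hE, hL]
  have := Real.pi_ne_zero
  field_simp
  ring



/-- Corollary 4.2 (equality case of Theorem 3.1): `Δ = 3π(A − F)` if and only
if the support function is of the form `a₀ + a₂ cos 2φ + b₂ sin 2φ`, i.e. the
curve is a circle or a curve parallel to an astroid. -/
theorem isoperimetric_deficit_eq_iff_astroid
    (p : ℝ → ℝ)
    (hper : Function.Periodic p (2 * π))
    (hC2 : ContDiff ℝ 2 p)
    (hconv : ∀ φ, p φ + deriv (deriv p) φ > 0)
    (hcos : ∫ φ in (0:ℝ)..(2 * π), p φ * Real.cos φ = 0)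
    (hsin : ∫ φ in (0:ℝ)..(2 * π), p φ * Real.sin φ = 0)
    (L F A Δ : ℝ)
    (hL : L = ∫ φ in (0:ℝ)..(2 * π), p φ)
    (hF : F = (1 / 2) * ∫ φ in (0:ℝ)..(2 * π), (p φ ^ 2 - (deriv p φ) ^ 2))
    (hA : A = (1 / 2) * ∫ φ in (0:ℝ)..(2 * π), p φ ^ 2)
    (hΔ : Δ = L ^ 2 - 4 * π * F) :
    Δ = 3 * π * (A - F) ↔
      ∃ a₀ a₂ b₂ : ℝ, ∀ φ : ℝ,
        p φ = a₀ + a₂ * Real.cos (2 * φ) + b₂ * Real.sin (2 * φ) := by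
  have hpi := Real.pi_pos
  have hdc : Continuous (deriv p) := hC2.continuous_deriv (by norm_num)
  have hc : Continuous p := hC2.continuous
  rw [intervalIntegral.integral_sub (by apply Continuous.intervalIntegrable; fun_prop)
    (by apply Continuous.intervalIntegrable; fun_prop)] at hF
  have key : Δ = 3 * π * (A - F) ↔
      (∫ φ in (0:ℝ)..(2 * π), deriv p φ ^ 2) - 4 * (∫ φ in (0:ℝ)..(2 * π), p φ ^ 2)
      + 2 / π * (∫ φ in (0:ℝ)..(2 * π), p φ) ^ 2 = 0 := by
    rw [hΔ, hA, hF, hL]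
    generalize (∫ φ in (0:ℝ)..(2 * π), deriv p φ ^ 2) = D
    generalize (∫ φ in (0:ℝ)..(2 * π), p φ ^ 2) = P
    generalize (∫ φ in (0:ℝ)..(2 * π), p φ) = M
    have : M ^ 2 - 4 * π * (1 / 2 * (P - D)) - 3 * π * (1 / 2 * P - 1 / 2 * (P - D))
        = π / 2 * (D - 4 * P + 2 / π * M ^ 2) := by field_simp; ring
    rw [← sub_eq_zero, this]
    simp [hpi.ne']
  rw [key]
  exact ⟨aux_forward p hper hC2 hcos hsin, fun ⟨a₀, a, b, h⟩ => aux_backward p a₀ a b h⟩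
end

section
/- Let p : ℝ → ℝ be a 2π-periodic function of class C² with p(φ) + p''(φ) > 0 for all φ, satisfying ∫₀^{2π} p(φ)cos φ dφ = 0 and ∫₀^{2π} p(φ)sin φ dφ = 0, and suppose there is a constant w with p(φ) + p(φ + π) = w for all φ. Set L = ∫₀^{2π} p dφ, F = ½∫₀^{2π}(p² − p'²) dφ, A = ½∫₀^{2π} p² dφ and Δ = L² − 4πF. Then Δ = (32/9)π(A − F) if and only if there exist constants a₀, a₃, b₃ such that p(φ) = a₀ + a₃cos(3φ) + b₃sin(3φ) for all φ (i.e., the curve is a circle or a curve parallel to a hypocycloid of three cusps). -/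
open Real

noncomputable def co (f : ℝ → ℝ) (n : ℤ) : ℂ :=
  (1 / (2 * π) : ℝ) • ∫ x in (0:ℝ)..(2 * π), Complex.exp (-(Complex.I * n * x)) * (f x : ℂ)

lemma fourier_exp (n : ℤ) (x : ℝ) :
    (fourier n (x : AddCircle (2 * π)) : ℂ) = Complex.exp (Complex.I * n * x) := by
  rw [fourier_coe_apply]
  congr 1
  have : (π : ℂ) ≠ 0 := by exact_mod_cast Real.pi_ne_zero
  push_cast
  field_simp

lemma co_on (f : ℝ → ℝ) (n : ℤ) :
    fourierCoeffOn Real.two_pi_pos (fun x => (f x : ℂ)) n = co f n := by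
  rw [fourierCoeffOn_eq_integral, co]
  simp only [sub_zero, smul_eq_mul]
  congr 1
  apply intervalIntegral.integral_congr
  intro x _
  have := fourier_exp (-n) x
  simp only
  have e : ((x : ℝ) : AddCircle (2 * π - 0)) = (x : AddCircle (2 * π - 0)) := rfl
  rw [fourier_coe_apply]
  congr 2
  have : (π : ℂ) ≠ 0 := by exact_mod_cast Real.pi_ne_zero
  push_cast
  field_simp
  simp
  ring

lemma co_parseval (f : ℝ → ℝ) (hf : Continuous f) :
    HasSum (fun n => ‖co f n‖ ^ 2) ((2 * π)⁻¹ * ∫ x in (0:ℝ)..(2 * π), f x ^ 2) := by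
  have h := hasSum_sq_fourierCoeffOn (f := fun x => (f x : ℂ)) Real.two_pi_pos (by
    have hc : Continuous (fun x => (f x : ℂ)) := by fun_prop
    rw [MeasureTheory.memLp_two_iff_integrable_sq_norm hc.aestronglyMeasurable]
    have : Continuous (fun x => ‖(f x : ℂ)‖ ^ 2) := by fun_prop
    exact (this.integrableOn_Icc (a := 0) (b := 2 * π)).mono_set Set.Ioc_subset_Icc_self)
  simpa [co_on] using h

lemma co_deriv (f f' : ℝ → ℝ) (hp : f (2 * π) = f 0) (hd : ∀ x, HasDerivAt f (f' x) x)
    (hc : Continuous f') (n : ℤ) : co f' n = Complex.I * n * co f n := by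
  by_cases hn : n = 0
  · subst hn
    have : ∫ x in (0:ℝ)..(2 * π), f' x = 0 := by
      rw [intervalIntegral.integral_eq_sub_of_hasDerivAt (fun x _ => hd x)
        (hc.intervalIntegrable _ _), hp, sub_self]
    simp [co, intervalIntegral.integral_ofReal, this]
  · have h := fourierCoeffOn_of_hasDerivAt (f := fun x => (f x : ℂ)) (f' := fun x => (f' x : ℂ))
      Real.two_pi_pos hn (fun x _ => (hd x).ofReal_comp)
      ((by fun_prop : Continuous (fun x => (f' x : ℂ))).intervalIntegrable _ _)
    rw [co_on, co_on, hp] at h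
    rw [h]
    have : (π : ℂ) ≠ 0 := by exact_mod_cast Real.pi_ne_zero
    have : (n : ℂ) ≠ 0 := by exact_mod_cast hn
    push_cast
    field_simp
    simp
    ring

lemma co_pointwise (f : ℝ → ℝ) (hper : Function.Periodic f (2 * π)) (hf : Continuous f)
    (h0 : ∀ n : ℤ, n ≠ 0 → n ≠ 3 → n ≠ -3 → co f n = 0) :
    ∃ a₀ a₃ b₃ : ℝ, ∀ φ : ℝ,
        f φ = a₀ + a₃ * Real.cos (3 * φ) + b₃ * Real.sin (3 * φ) := by
  haveI : Fact (0 < 2 * π) := ⟨Real.two_pi_pos⟩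
  have hper' : Function.Periodic (fun x => (f x : ℂ)) (2 * π) := fun x => by simp [hper x]
  have hc : Continuous (fun x => (f x : ℂ)) := by fun_prop
  let g : C(AddCircle (2 * π), ℂ) := ⟨hper'.lift, continuous_coinduced_dom.mpr hc⟩
  have hg : ∀ x : ℝ, g (x : AddCircle (2 * π)) = f x := fun x => hper'.lift_coe x
  have hco : ∀ n, fourierCoeff g n = co f n := by
    intro n
    rw [fourierCoeff_eq_intervalIntegral _ _ 0, co]
    simp only [zero_add, hg, fourier_exp, smul_eq_mul]
    congr 2
    ext x
    push_cast
    ring_nf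
  have hz : ∀ n ∉ ({0, 3, -3} : Finset ℤ), fourierCoeff g n = 0 := by
    intro n hn
    simp at hn
    rw [hco]
    exact h0 n hn.1 hn.2.1 hn.2.2
  have hs : Summable (fourierCoeff g) := summable_of_ne_finset_zero hz
  refine ⟨(co f 0).re, (co f 3 + co f (-3)).re, -(co f 3 - co f (-3)).im, fun x => ?_⟩
  have h1 := has_pointwise_sum_fourier_series_of_summable hs (x : AddCircle (2 * π))
  have h2 := h1.unique (hasSum_sum_of_ne_finset_zero (s := ({0, 3, -3} : Finset ℤ))
    (fun n hn => by rw [hz n hn, zero_smul]))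
  rw [hg] at h2
  rw [Finset.sum_insert (by decide), Finset.sum_insert (by decide), Finset.sum_singleton] at h2
  simp only [hco, fourier_exp, smul_eq_mul] at h2
  have e3 : Complex.exp (Complex.I * ((3:ℤ):ℂ) * x) = Real.cos (3 * x) + Real.sin (3 * x) * Complex.I := by
    rw [Complex.ofReal_cos, Complex.ofReal_sin, ← Complex.exp_mul_I]; congr 1; push_cast; ring
  have e3' : Complex.exp (Complex.I * ((-3:ℤ):ℂ) * x) = Real.cos (3 * x) - Real.sin (3 * x) * Complex.I := by
    have := Complex.exp_mul_I ((-(3 * x) : ℝ) : ℂ)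
    rw [← Complex.ofReal_cos, ← Complex.ofReal_sin, Real.cos_neg, Real.sin_neg] at this
    rw [sub_eq_add_neg, ← neg_mul, ← Complex.ofReal_neg, ← this]; congr 1; push_cast; ring
  rw [e3, e3'] at h2
  have h3 := congrArg Complex.re h2
  simp only [Complex.add_re, Complex.sub_re, Complex.mul_re, Complex.add_im, Complex.sub_im,
    Complex.mul_im, Complex.ofReal_re, Complex.ofReal_im, Complex.I_re, Complex.I_im] at h3
  simp at h3
  simp only [Complex.add_re, Complex.sub_im]
  rw [h3]
  ring

lemma co_split (f : ℝ → ℝ) (hf : Continuous f) (n : ℤ)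
    (hc : ∫ x in (0:ℝ)..(2 * π), f x * Real.cos (n * x) = 0)
    (hs : ∫ x in (0:ℝ)..(2 * π), f x * Real.sin (n * x) = 0) : co f n = 0 := by
  have e : ∀ x : ℝ, Complex.exp (-(Complex.I * n * x)) * (f x : ℂ)
      = ((f x * Real.cos (n * x) : ℝ) : ℂ) - Complex.I * ((f x * Real.sin (n * x) : ℝ) : ℂ) := by
    intro x
    have := Complex.exp_mul_I ((-(n * x) : ℝ) : ℂ)
    rw [← Complex.ofReal_cos, ← Complex.ofReal_sin, Real.cos_neg, Real.sin_neg] at this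
    rw [show -(Complex.I * n * x) = ((-(n * x) : ℝ) : ℂ) * Complex.I by push_cast; ring, this]
    push_cast
    ring
  rw [co]
  simp_rw [e]
  rw [intervalIntegral.integral_sub, intervalIntegral.integral_const_mul,
    intervalIntegral.integral_ofReal, intervalIntegral.integral_ofReal, hc, hs]
  · simp
  · exact Continuous.intervalIntegrable (by fun_prop) _ _
  · exact Continuous.intervalIntegrable (by fun_prop) _ _

lemma co_zero (f : ℝ → ℝ) : ‖co f 0‖ ^ 2 = ((2 * π)⁻¹ * ∫ x in (0:ℝ)..(2 * π), f x) ^ 2 := by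
  have : co f 0 = (((2 * π)⁻¹ * ∫ x in (0:ℝ)..(2 * π), f x : ℝ) : ℂ) := by
    simp [co, intervalIntegral.integral_ofReal]
  rw [this, Complex.norm_real, Real.norm_eq_abs, sq_abs]

/-- even mode vanishing -/
lemma even_mode (f g : ℝ → ℝ) (hf : Continuous f) (hg : Continuous g)
    (hfp : Function.Periodic f (2 * π)) (hgp : Function.Periodic g π) (w : ℝ)
    (hw : ∀ x, f x + f (x + π) = w) (hg0 : ∫ x in (0:ℝ)..(2 * π), g x = 0) :
    ∫ x in (0:ℝ)..(2 * π), f x * g x = 0 := by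
  have hgp2 : Function.Periodic g (2 * π) := by
    intro x; rw [two_mul, ← add_assoc, hgp, hgp]
  have h1 : ∫ x in (0:ℝ)..(2 * π), f (x + π) * g (x + π) = ∫ x in (0:ℝ)..(2 * π), f x * g x := by
    rw [intervalIntegral.integral_comp_add_right (fun x => f x * g x)]
    have := (hfp.mul hgp2).intervalIntegral_add_eq π 0
    simp only [Pi.mul_apply] at this
    rw [zero_add] at this
    rw [← this]
    congr 1 <;> ring
  have h2 : ∫ x in (0:ℝ)..(2 * π), (f x * g x + f (x + π) * g (x + π)) = 0 := by
    have : ∀ x, f x * g x + f (x + π) * g (x + π) = w * g x := by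
      intro x; rw [hgp x, ← hw x]; ring
    simp_rw [this]
    rw [intervalIntegral.integral_const_mul, hg0, mul_zero]
  rw [intervalIntegral.integral_add (Continuous.intervalIntegrable (by fun_prop) _ _)
    (Continuous.intervalIntegrable (by fun_prop) _ _), h1] at h2
  linarith

/-- Corollary 4.5 (equality case of Proposition 3.2): for a constant width
set, `Δ = (32/9)π(A − F)` if and only if the support function is of the form
`a₀ + a₃ cos 3φ + b₃ sin 3φ`, i.e. the curve is a circle or a curve parallel
to a hypocycloid of three cusps. -/
theorem isoperimetric_deficit_eq_iff_hypocycloid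
    (p : ℝ → ℝ)
    (hper : Function.Periodic p (2 * π))
    (hC2 : ContDiff ℝ 2 p)
    (hconv : ∀ φ, p φ + deriv (deriv p) φ > 0)
    (hcos : ∫ φ in (0:ℝ)..(2 * π), p φ * Real.cos φ = 0)
    (hsin : ∫ φ in (0:ℝ)..(2 * π), p φ * Real.sin φ = 0)
    (w : ℝ) (hwidth : ∀ φ, p φ + p (φ + π) = w)
    (L F A Δ : ℝ)
    (hL : L = ∫ φ in (0:ℝ)..(2 * π), p φ)
    (hF : F = (1 / 2) * ∫ φ in (0:ℝ)..(2 * π), (p φ ^ 2 - (deriv p φ) ^ 2))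
    (hA : A = (1 / 2) * ∫ φ in (0:ℝ)..(2 * π), p φ ^ 2)
    (hΔ : Δ = L ^ 2 - 4 * π * F) :
    Δ = (32 / 9) * π * (A - F) ↔
      ∃ a₀ a₃ b₃ : ℝ, ∀ φ : ℝ,
        p φ = a₀ + a₃ * Real.cos (3 * φ) + b₃ * Real.sin (3 * φ) := by
  have hpi := Real.pi_pos
  have hd : ∀ x, HasDerivAt p (deriv p x) x := fun x =>
    (hC2.differentiable (by norm_num) x).hasDerivAt
  have hc : Continuous p := hC2.continuous
  have hc' : Continuous (deriv p) := hC2.continuous_deriv (by norm_num)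
  have hF' : F = (1 / 2) * ((∫ φ in (0:ℝ)..(2 * π), p φ ^ 2)
      - ∫ φ in (0:ℝ)..(2 * π), (deriv p φ) ^ 2) := by
    rw [hF, intervalIntegral.integral_sub (Continuous.intervalIntegrable (by fun_prop) _ _)
      (Continuous.intervalIntegrable (by fun_prop) _ _)]
  have hp0 : p (2 * π) = p 0 := by simpa using hper 0
  set P := ∫ φ in (0:ℝ)..(2 * π), p φ ^ 2 with hP
  set D := ∫ φ in (0:ℝ)..(2 * π), (deriv p φ) ^ 2 with hD
  have key : Δ = (32 / 9) * π * (A - F) ↔ 2 * π * D = 9 * (2 * π * P) - 9 * L ^ 2 := by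
    rw [hΔ, hA, hF']
    constructor <;> intro h <;> linarith
  rw [key]
  constructor
  · intro h
    apply co_pointwise p hper hc
    have s1 := co_parseval p hc
    have s2 := co_parseval (deriv p) hc'
    have hn : ∀ n : ℤ, ‖co (deriv p) n‖ ^ 2 = (n:ℝ) ^ 2 * ‖co p n‖ ^ 2 := by
      intro n
      rw [co_deriv p (deriv p) hp0 hd hc' n]
      simp [mul_pow]
    simp_rw [hn] at s2
    have s3 := hasSum_ite_eq (0:ℤ) (9 * ‖co p 0‖ ^ 2)
    have s4 := (s2.sub (s1.mul_left 9)).add s3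
    have hz : (2 * π)⁻¹ * D - 9 * ((2 * π)⁻¹ * P) + 9 * ‖co p 0‖ ^ 2 = 0 := by
      rw [co_zero, ← hL]
      field_simp
      linarith
    rw [← hP, ← hD, hz] at s4
    have c1 : co p 1 = 0 := co_split p hc 1 (by simpa using hcos) (by simpa using hsin)
    have c1' : co p (-1) = 0 := co_split p hc (-1) (by simpa using hcos) (by simpa using hsin)
    have z1 : ∫ x in (0:ℝ)..(2 * π), p x * Real.cos (2 * x) = 0 := by
      apply even_mode p _ hc (by fun_prop) hper _ w hwidth
      · rw [intervalIntegral.integral_comp_mul_left _ (by norm_num : (2:ℝ) ≠ 0)]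
        have : Real.sin (2 * (2 * π)) = 0 := by
          have := Real.sin_nat_mul_pi 4
          rw [← this]; congr 1; push_cast; ring
        simp [this]
      · intro x
        simp only
        rw [mul_add, Real.cos_add_two_pi]
    have z2 : ∫ x in (0:ℝ)..(2 * π), p x * Real.sin (2 * x) = 0 := by
      apply even_mode p _ hc (by fun_prop) hper _ w hwidth
      · rw [intervalIntegral.integral_comp_mul_left _ (by norm_num : (2:ℝ) ≠ 0)]
        have : Real.cos (2 * (2 * π)) = 1 := by
          have := Real.cos_nat_mul_two_pi 2
          rw [← this]; congr 1
        simp [this]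
      · intro x
        simp only
        rw [mul_add, Real.sin_add_two_pi]
    have c2 : co p 2 = 0 := co_split p hc 2 (by simpa using z1) (by simpa using z2)
    have c2' : co p (-2) = 0 := co_split p hc (-2) (by simpa using z1) (by simpa using z2)
    have hbig : ∀ n : ℤ, n ≠ 0 → n ≠ 1 → n ≠ -1 → n ≠ 2 → n ≠ -2 → (9:ℝ) ≤ (n:ℝ) ^ 2 := by
      intro n _ _ _ _ _
      have : (9:ℤ) ≤ n ^ 2 := by
        rcases (by omega : 3 ≤ n ∨ n ≤ -3) with h | h <;> nlinarith
      exact_mod_cast this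
    have hnn := (hasSum_zero_iff_of_nonneg (by
      intro n
      by_cases h0 : n = 0
      · subst h0; simp
      by_cases h1 : n = 1
      · subst h1; simp [c1]
      by_cases h2 : n = -1
      · subst h2; simp [c1']
      by_cases h3 : n = 2
      · subst h3; simp [c2]
      by_cases h4 : n = -2
      · subst h4; simp [c2']
      rw [if_neg h0]
      have := hbig n h0 h1 h2 h3 h4
      nlinarith [sq_nonneg ‖co p n‖])).1 s4
    intro n h0 h3 h3'
    by_cases h1 : n = 1
    · rw [h1, c1]
    by_cases h2 : n = -1
    · rw [h2, c1']
    by_cases h4 : n = 2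
    · rw [h4, c2]
    by_cases h5 : n = -2
    · rw [h5, c2']
    have := congrFun hnn n
    simp only [if_neg h0, Pi.zero_apply, add_zero] at this
    have hne : (n:ℝ) ^ 2 - 9 ≠ 0 := by
      have : n ^ 2 - 9 ≠ 0 := by
        intro hh
        have : (n - 3) * (n + 3) = 0 := by linarith
        rcases mul_eq_zero.1 this with h | h <;> omega
      exact_mod_cast this
    have : ((n:ℝ) ^ 2 - 9) * ‖co p n‖ ^ 2 = 0 := by linarith
    simpa [hne] using this
  · rintro ⟨a, b, c, h⟩
    have hpe : p = fun φ => a + b * Real.cos (3 * φ) + c * Real.sin (3 * φ) := funext h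
    have d3 : ∀ x : ℝ, HasDerivAt (fun x : ℝ => 3 * x) 3 x := fun x => by
      simpa using (hasDerivAt_id x).const_mul (3:ℝ)
    have hd1 : ∀ x, deriv p x = -3 * b * Real.sin (3 * x) + 3 * c * Real.cos (3 * x) := by
      intro x
      rw [hpe]
      have := (((d3 x).cos.const_mul b).const_add a).add ((d3 x).sin.const_mul c)
      refine HasDerivAt.deriv (this.congr_deriv ?_)
      ring
    have hd2 : ∀ x, HasDerivAt (deriv p) (-9 * (p x - a)) x := by
      intro x
      rw [funext hd1, h x]
      have := ((d3 x).sin.const_mul (-3 * b)).add ((d3 x).cos.const_mul (3 * c))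
      refine this.congr_deriv ?_
      ring
    have hdp0 : deriv p (2 * π) = deriv p 0 := by
      have e1 : Real.sin (3 * (2 * π)) = 0 := by
        have := Real.sin_nat_mul_pi 6
        rw [← this]; congr 1; push_cast; ring
      have e2 : Real.cos (3 * (2 * π)) = 1 := by
        have := Real.cos_nat_mul_two_pi 3
        rw [← this]; congr 1
      rw [hd1, hd1, e1, e2]; simp
    have i1 : ∫ x in (0:ℝ)..(2 * π), (-9 * (p x - a)) = 0 := by
      rw [intervalIntegral.integral_eq_sub_of_hasDerivAt (fun x _ => hd2 x)
        (Continuous.intervalIntegrable (by fun_prop) _ _), hdp0, sub_self]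
    have i2 : ∫ x in (0:ℝ)..(2 * π), (deriv p x * deriv p x + (p x - a) * (-9 * (p x - a))) = 0 := by
      rw [intervalIntegral.integral_eq_sub_of_hasDerivAt
        (fun x _ => ((hd x).sub_const a).mul (hd2 x))
        (Continuous.intervalIntegrable (by fun_prop) _ _)]
      simp [hdp0, hp0]
    have ii : ∀ f : ℝ → ℝ, Continuous f → IntervalIntegrable f MeasureTheory.volume 0 (2 * π) :=
      fun f hf => hf.intervalIntegrable _ _
    have i1' : L = 2 * π * a := by
      rw [intervalIntegral.integral_const_mul, intervalIntegral.integral_sub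
        (ii _ hc) (ii _ continuous_const), ← hL] at i1
      simp at i1
      linarith
    have i2' : D - 9 * P + 18 * a * L - 9 * a ^ 2 * (2 * π) = 0 := by
      have e : ∀ x, deriv p x * deriv p x + (p x - a) * (-9 * (p x - a))
        = deriv p x ^ 2 - 9 * p x ^ 2 + 18 * a * p x - 9 * a ^ 2 := by intro x; ring
      simp_rw [e] at i2
      rw [intervalIntegral.integral_sub (ii _ (by fun_prop)) (ii _ (by fun_prop)),
        intervalIntegral.integral_add (ii _ (by fun_prop)) (ii _ (by fun_prop)),
        intervalIntegral.integral_sub (ii _ (by fun_prop)) (ii _ (by fun_prop)),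
        intervalIntegral.integral_const_mul, intervalIntegral.integral_const_mul,
        ← hL, ← hP, ← hD] at i2
      simp at i2
      linarith
    rw [i1'] at i2' ⊢
    linear_combination 2 * π * i2'
end

section
/- Let p : ℝ → ℝ be a 2π-periodic function of class C². Set L = ∫₀^{2π} p dφ, F = ½∫₀^{2π}(p² − p'²) dφ, Δ = L² − 4πF, and F_e = ½∫₀^{2π} p'² dφ − ½∫₀^{2π} p''² dφ. Then Δ = π|F_e| if and only if there exist constants a₀, a₁, b₁, a₂, b₂ such that p(φ) = a₀ + a₁cos φ + b₁sin φ + a₂cos(2φ) + b₂sin(2φ) for all φ (i.e., the curve is a circle or parallel to an astroid). Equivalently, since Δ = −4πF_{L/2π} with F_{L/2π} = F − L²/(4π), the curves for which the area of the evolute is four times the area of the interior parallel curve at distance L/(2π) are exactly these. -/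
open Real

noncomputable def hwC (f : ℝ → ℝ) (n : ℤ) : ℂ :=
  (1 / (2 * π) : ℂ) * ∫ x in (0:ℝ)..(2 * π), Complex.exp (-(n * x * Complex.I)) * (f x : ℂ)

lemma hwC_eq (f : ℝ → ℝ) (n : ℤ) :
    hwC f n = fourierCoeffOn Real.two_pi_pos (fun x => (f x : ℂ)) n := by
  rw [fourierCoeffOn_eq_integral, hwC]
  have hpi : (π : ℂ) ≠ 0 := by exact_mod_cast Real.pi_ne_zero
  have : ∀ x : ℝ, (fourier (-n) (x : AddCircle (2 * π - 0)) : ℂ)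
      = Complex.exp (-(n * x * Complex.I)) := by
    intro x
    rw [fourier_coe_apply]
    congr 1
    push_cast
    field_simp
    ring
  simp only [this, smul_eq_mul, Complex.real_smul]
  push_cast
  simp

lemma hwC_parseval (f : ℝ → ℝ) (hf : Continuous f) :
    HasSum (fun n => ‖hwC f n‖ ^ 2) ((2 * π)⁻¹ * ∫ x in (0:ℝ)..(2 * π), f x ^ 2) := by
  have hL : MeasureTheory.MemLp (fun x => (f x : ℂ)) 2
      (MeasureTheory.volume.restrict (Set.Ioc 0 (2 * π))) := by
    have hc : Continuous (fun x => (f x : ℂ)) := by fun_prop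
    obtain ⟨B, hB⟩ := isCompact_Icc.exists_bound_of_continuousOn (s := Set.Icc 0 (2 * π)) hc.continuousOn
    refine MeasureTheory.MemLp.of_bound hc.aestronglyMeasurable B ?_
    exact MeasureTheory.ae_restrict_of_forall_mem measurableSet_Ioc
      fun x hx => hB x (Set.Ioc_subset_Icc_self hx)
  have := hasSum_sq_fourierCoeffOn Real.two_pi_pos hL
  simpa [hwC_eq] using this

lemma hwC_deriv (f f' : ℝ → ℝ) (hper : f (2 * π) = f 0) (hf : ∀ x, HasDerivAt f (f' x) x)
    (hf' : Continuous f') (n : ℤ) : hwC f' n = Complex.I * n * hwC f n := by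
  have hd : ∀ x : ℝ, HasDerivAt (fun x : ℝ => Complex.exp (-(n * x * Complex.I)) * (f x : ℂ))
      (Complex.exp (-(n * x * Complex.I)) * (f' x : ℂ)
        - Complex.I * n * (Complex.exp (-(n * x * Complex.I)) * (f x : ℂ))) x := by
    intro x
    have h1 : HasDerivAt (fun x : ℝ => -((n:ℂ) * x * Complex.I)) (-((n:ℂ) * 1 * Complex.I)) x :=
      (((Complex.ofRealCLM.hasDerivAt (x := x)).const_mul (n:ℂ)).mul_const Complex.I).neg
    have h2 := h1.cexp.mul (hf x).ofReal_comp
    refine h2.congr_deriv ?_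
    ring
  have hfc : Continuous f := continuous_iff_continuousAt.2 fun x => (hf x).continuousAt
  have hi := intervalIntegral.integral_eq_sub_of_hasDerivAt (a := 0) (b := 2 * π)
    (fun x _ => hd x) (Continuous.intervalIntegrable (by fun_prop) _ _)
  rw [intervalIntegral.integral_sub (Continuous.intervalIntegrable (by fun_prop) _ _)
    (Continuous.intervalIntegrable (by fun_prop) _ _),
    intervalIntegral.integral_const_mul] at hi
  have he : Complex.exp (-((n:ℂ) * ((2 * π : ℝ) : ℂ) * Complex.I)) = 1 := by
    rw [Complex.exp_eq_one_iff]
    exact ⟨-n, by push_cast; ring⟩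
  rw [he, hper] at hi
  simp only [Complex.ofReal_zero, mul_zero, zero_mul, neg_zero, Complex.exp_zero, sub_self] at hi
  unfold hwC
  linear_combination (1 / (2 * π) : ℂ) * hi

lemma hwC_add (f g : ℝ → ℝ) (hf : Continuous f) (hg : Continuous g) (n : ℤ) :
    hwC (fun x => f x + g x) n = hwC f n + hwC g n := by
  unfold hwC
  rw [← mul_add, ← intervalIntegral.integral_add (Continuous.intervalIntegrable (by fun_prop) _ _)
    (Continuous.intervalIntegrable (by fun_prop) _ _)]
  push_cast
  simp only [mul_add]

lemma hwC_smul (f : ℝ → ℝ) (c : ℝ) (n : ℤ) :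
    hwC (fun x => c * f x) n = c * hwC f n := by
  unfold hwC
  rw [mul_left_comm, ← intervalIntegral.integral_const_mul (c : ℂ)]
  push_cast
  simp only [mul_left_comm (c : ℂ)]

lemma hwC_trig_zero (k : ℤ) (n : ℤ) (h : k ^ 2 ≠ n ^ 2) :
    hwC (fun x => Real.cos (k * x)) n = 0 ∧ hwC (fun x => Real.sin (k * x)) n = 0 := by
  have hl : ∀ x : ℝ, HasDerivAt (fun x : ℝ => (k:ℝ) * x) k x := fun x => by
    simpa using (hasDerivAt_id x).const_mul (k:ℝ)
  have e1 := hwC_deriv (fun x => Real.cos (k * x)) (fun x => (-k : ℝ) * Real.sin (k * x))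
    (by simpa using Real.cos_int_mul_two_pi k)
    (fun x => by convert (hl x).cos using 1; ring) (by fun_prop) n
  have e2 := hwC_deriv (fun x => Real.sin (k * x)) (fun x => (k : ℝ) * Real.cos (k * x))
    (by simpa using Real.sin_periodic.int_mul_eq k)
    (fun x => by convert (hl x).sin using 1; ring) (by fun_prop) n
  rw [hwC_smul] at e1 e2
  push_cast at e1 e2
  have hk : (k:ℂ) ^ 2 - n ^ 2 ≠ 0 := by
    rw [sub_ne_zero]; exact_mod_cast h
  constructor
  · apply (mul_eq_zero.1 (_ : ((k:ℂ) ^ 2 - n ^ 2) * _ = 0)).resolve_left hk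
    linear_combination (k:ℂ) * e2 - Complex.I * n * e1 - n ^ 2 * hwC (fun x => Real.cos (k * x)) n * Complex.I_sq
  · apply (mul_eq_zero.1 (_ : ((k:ℂ) ^ 2 - n ^ 2) * _ = 0)).resolve_left hk
    linear_combination -(k:ℂ) * e1 - Complex.I * n * e2 - n ^ 2 * hwC (fun x => Real.sin (k * x)) n * Complex.I_sq

lemma hwC_trig (p : ℝ → ℝ) (a₀ a₁ b₁ a₂ b₂ : ℝ) (hp : ∀ φ : ℝ,
        p φ = a₀ + a₁ * Real.cos φ + b₁ * Real.sin φ +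
          a₂ * Real.cos (2 * φ) + b₂ * Real.sin (2 * φ)) (n : ℤ) (hn : 3 ≤ |n|) :
    hwC p n = 0 := by
  have hsq : 9 ≤ n ^ 2 := by rw [← sq_abs]; nlinarith
  have h0 := hwC_trig_zero 0 n (by intro h; rw [← h] at hsq; norm_num at hsq)
  have h1 := hwC_trig_zero 1 n (by intro h; rw [← h] at hsq; norm_num at hsq)
  have h2 := hwC_trig_zero 2 n (by intro h; rw [← h] at hsq; norm_num at hsq)
  have : p = fun φ => (((a₀ * Real.cos ((0:ℤ) * φ) + a₁ * Real.cos ((1:ℤ) * φ)) + b₁ * Real.sin ((1:ℤ) * φ)) +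
          a₂ * Real.cos ((2:ℤ) * φ)) + b₂ * Real.sin ((2:ℤ) * φ) := by
    funext φ
    rw [hp]; simp
  rw [this, hwC_add _ _ (by fun_prop) (by fun_prop), hwC_add _ _ (by fun_prop) (by fun_prop),
    hwC_add _ _ (by fun_prop) (by fun_prop), hwC_add _ _ (by fun_prop) (by fun_prop)]
  simp only [hwC_smul, h0, h1, h2]
  simp

lemma hwC_recon (p : ℝ → ℝ) (hper : Function.Periodic p (2 * π)) (hc : Continuous p)
    (h : ∀ n : ℤ, 3 ≤ |n| → hwC p n = 0) :
    ∃ a₀ a₁ b₁ a₂ b₂ : ℝ, ∀ φ : ℝ,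
        p φ = a₀ + a₁ * Real.cos φ + b₁ * Real.sin φ +
          a₂ * Real.cos (2 * φ) + b₂ * Real.sin (2 * φ) := by
  have : Fact (0 < 2 * π) := ⟨Real.two_pi_pos⟩
  have hpi : (π : ℂ) ≠ 0 := by exact_mod_cast Real.pi_ne_zero
  have hper' : Function.Periodic (fun x => (p x : ℂ)) (2 * π) := fun x => by simp [hper x]
  let G : C(AddCircle (2 * π), ℂ) := ⟨hper'.lift, by
    apply continuous_coinduced_dom.2
    show Continuous (fun x => (p x : ℂ))
    fun_prop⟩
  have hG : ∀ x : ℝ, G x = p x := fun x => rfl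
  have hco : ∀ n, fourierCoeff G n = hwC p n := by
    intro n
    rw [fourierCoeff_eq_intervalIntegral _ _ 0, hwC]
    have : ∀ x : ℝ, (fourier (-n) (x : AddCircle (2 * π)) : ℂ)
        = Complex.exp (-(n * x * Complex.I)) := by
      intro x
      rw [fourier_coe_apply]
      congr 1
      push_cast
      field_simp
    simp only [this, smul_eq_mul, Complex.real_smul, hG, zero_add]
    push_cast
    rfl
  have hz : ∀ n ∉ Finset.Icc (-2 : ℤ) 2, hwC p n = 0 := by
    intro n hn
    apply h
    rw [Finset.mem_Icc] at hn
    rcases abs_cases n with h | h <;> omega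
  have hs : Summable (fourierCoeff G) := summable_of_ne_finset_zero (s := Finset.Icc (-2 : ℤ) 2)
    (fun n hn => by rw [hco, hz n hn])
  have key : ∀ x : ℝ, (p x : ℂ) = ∑ n ∈ Finset.Icc (-2 : ℤ) 2, hwC p n * Complex.exp (n * x * Complex.I) := by
    intro x
    have h1 := has_pointwise_sum_fourier_series_of_summable hs (x : AddCircle (2 * π))
    rw [hG] at h1
    refine h1.unique ?_
    have e : (fun i => fourierCoeff G i • (fourier i (x : AddCircle (2 * π)) : ℂ))
        = fun n : ℤ => hwC p n * Complex.exp (n * x * Complex.I) := by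
      funext n
      rw [hco, fourier_coe_apply, smul_eq_mul]
      congr 2
      push_cast
      field_simp
    rw [e]
    exact hasSum_sum_of_ne_finset_zero (fun n hn => by rw [hz n hn, zero_mul])
  have hre : ∀ (n : ℤ) (x : ℝ), (hwC p n * Complex.exp (n * x * Complex.I)).re
      = (hwC p n).re * Real.cos (n * x) - (hwC p n).im * Real.sin (n * x) := by
    intro n x
    have : (n * x * Complex.I : ℂ) = ((n * x : ℝ) : ℂ) * Complex.I := by push_cast; ring
    rw [this, Complex.mul_re, Complex.exp_ofReal_mul_I_re, Complex.exp_ofReal_mul_I_im]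
  refine ⟨(hwC p 0).re, (hwC p 1).re + (hwC p (-1)).re, (hwC p (-1)).im - (hwC p 1).im,
    (hwC p 2).re + (hwC p (-2)).re, (hwC p (-2)).im - (hwC p 2).im, fun x => ?_⟩
  have h2 := congrArg Complex.re (key x)
  rw [Complex.re_sum, show Finset.Icc (-2 : ℤ) 2 = {-2, -1, 0, 1, 2} by decide] at h2
  simp only [hre] at h2
  simp at h2
  rw [h2]
  ring

/-- Equality case in Hurwitz's inequality: `Δ = π|F_e|` iff the support
function has the form `a₀ + a₁cos φ + b₁sin φ + a₂cos 2φ + b₂sin 2φ`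
(circles or curves parallel to an astroid); equivalently, since
`Δ = −4πF_{L/2π}`, these are exactly the curves for which the area of the
evolute is four times the area of the interior parallel curve at distance
`L/(2π)`. -/
theorem hurwitz_equality_iff_astroid
    (p : ℝ → ℝ)
    (hper : Function.Periodic p (2 * π))
    (hC2 : ContDiff ℝ 2 p)
    (L F Δ Fe : ℝ)
    (hL : L = ∫ φ in (0:ℝ)..(2 * π), p φ)
    (hF : F = (1 / 2) * ∫ φ in (0:ℝ)..(2 * π), (p φ ^ 2 - (deriv p φ) ^ 2))
    (hΔ : Δ = L ^ 2 - 4 * π * F)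
    (hFe : Fe = (1 / 2) * (∫ φ in (0:ℝ)..(2 * π), (deriv p φ) ^ 2) -
            (1 / 2) * ∫ φ in (0:ℝ)..(2 * π), (deriv (deriv p) φ) ^ 2) :
    (Δ = π * |Fe| ↔
      ∃ a₀ a₁ b₁ a₂ b₂ : ℝ, ∀ φ : ℝ,
        p φ = a₀ + a₁ * Real.cos φ + b₁ * Real.sin φ +
          a₂ * Real.cos (2 * φ) + b₂ * Real.sin (2 * φ)) ∧
    (|Fe| = 4 * |F - L ^ 2 / (4 * π)| ↔
      ∃ a₀ a₁ b₁ a₂ b₂ : ℝ, ∀ φ : ℝ,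
        p φ = a₀ + a₁ * Real.cos φ + b₁ * Real.sin φ +
          a₂ * Real.cos (2 * φ) + b₂ * Real.sin (2 * φ)) := by
  have hpi := Real.pi_pos
  have hd1 : Differentiable ℝ p := hC2.differentiable (by norm_num)
  have hC1 : ContDiff ℝ 1 (deriv p) := by
    have : ContDiff ℝ (1 + 1) p := by norm_num; exact hC2
    exact (contDiff_succ_iff_deriv.1 this).2.2
  have hd2 : Differentiable ℝ (deriv p) := hC1.differentiable (by norm_num)
  have hc0 := hC2.continuous
  have hc1 := hC1.continuous
  have hc2 : Continuous (deriv (deriv p)) := hC1.continuous_deriv (by norm_num)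
  have hper1 : deriv p (2 * π) = deriv p 0 := by
    have : (fun x => p (x + 2 * π)) = p := funext hper
    have h2 := deriv_comp_add_const p (2 * π) 0
    rw [this, zero_add] at h2
    exact h2.symm
  have e1 := hwC_deriv p (deriv p) (by simpa using hper 0) (fun x => (hd1 x).hasDerivAt) hc1
  have e2 := hwC_deriv (deriv p) (deriv (deriv p)) hper1 (fun x => (hd2 x).hasDerivAt) hc2
  have n1 : ∀ n : ℤ, ‖hwC (deriv p) n‖ ^ 2 = (n:ℝ) ^ 2 * ‖hwC p n‖ ^ 2 := by
    intro n; rw [e1]; simp [mul_pow]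
  have n2 : ∀ n : ℤ, ‖hwC (deriv (deriv p)) n‖ ^ 2 = (n:ℝ) ^ 4 * ‖hwC p n‖ ^ 2 := by
    intro n; rw [e2, e1]; simp [mul_pow]; ring
  have H0 := hwC_parseval p hc0
  have H1 := hwC_parseval _ hc1
  have H2 := hwC_parseval _ hc2
  simp only [n1] at H1
  simp only [n2] at H2
  have hc : ‖hwC p 0‖ ^ 2 = ((2 * π)⁻¹ * L) ^ 2 := by
    have : hwC p 0 = (((2 * π)⁻¹ * L : ℝ) : ℂ) := by
      rw [hL, hwC]
      push_cast
      rw [← intervalIntegral.integral_ofReal]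
      simp
    rw [this, Complex.norm_real, Real.norm_eq_abs, sq_abs]
  rw [intervalIntegral.integral_sub (Continuous.intervalIntegrable (by fun_prop) _ _)
    (Continuous.intervalIntegrable (by fun_prop) _ _)] at hF
  set A0 := ∫ x in (0:ℝ)..(2 * π), p x ^ 2
  set A1 := ∫ x in (0:ℝ)..(2 * π), deriv p x ^ 2
  set A2 := ∫ x in (0:ℝ)..(2 * π), deriv (deriv p) x ^ 2
  have HZ : HasSum (fun n : ℤ => if n = 0 then ‖hwC p 0‖ ^ 2 else 0) (‖hwC p 0‖ ^ 2) := by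
    exact hasSum_ite_eq 0 _
  -- three sums
  have S1 := (H1.sub H0).add HZ
  have S2 := H2.sub H1
  have S3 := ((H2.sub (H1.mul_left 5)).add (H0.mul_left 4)).sub (HZ.mul_left 4)
  have int_sq : ∀ n : ℤ, n ≠ 0 → (1:ℝ) ≤ (n:ℝ) ^ 2 := by
    intro n hn
    have : 1 ≤ n ^ 2 := by have := sq_pos_of_ne_zero hn; omega
    exact_mod_cast this
  have hΔ0 : 0 ≤ Δ := by
    have := S1.nonneg (fun n => by
      by_cases hn : n = 0
      · subst hn; simp
      · simp only [hn, if_false]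
        nlinarith [int_sq n hn, sq_nonneg ‖hwC p n‖])
    rw [hc] at this
    have h2 : Δ = (2 * π) ^ 2 * ((2 * π)⁻¹ * A1 - (2 * π)⁻¹ * A0 + ((2 * π)⁻¹ * L) ^ 2) := by
      rw [hΔ, hF]; field_simp; ring
    rw [h2]; positivity
  have hFe0 : Fe ≤ 0 := by
    have := S2.nonneg (fun n => by
      by_cases hn : n = 0
      · subst hn; simp
      · have h1 := int_sq n hn
        have : (n:ℝ) ^ 4 * ‖hwC p n‖ ^ 2 - (n:ℝ) ^ 2 * ‖hwC p n‖ ^ 2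
          = (n:ℝ) ^ 2 * ((n:ℝ) ^ 2 - 1) * ‖hwC p n‖ ^ 2 := by ring
        simp only [this]
        have : 0 ≤ (n:ℝ) ^ 2 - 1 := by linarith
        positivity)
    have h2 : Fe = - (π * ((2 * π)⁻¹ * A2 - (2 * π)⁻¹ * A1)) := by
      rw [hFe]; field_simp; ring
    rw [h2]
    have := mul_nonneg hpi.le this
    linarith
  have hterm : (fun n : ℤ => (n:ℝ) ^ 4 * ‖hwC p n‖ ^ 2 - 5 * ((n:ℝ) ^ 2 * ‖hwC p n‖ ^ 2)
      + 4 * ‖hwC p n‖ ^ 2 - 4 * (if n = 0 then ‖hwC p 0‖ ^ 2 else 0))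
      = fun n : ℤ => if n = 0 then 0 else ((n:ℝ) ^ 2 - 1) * ((n:ℝ) ^ 2 - 4) * ‖hwC p n‖ ^ 2 := by
    funext n
    by_cases hn : n = 0
    · subst hn; simp
    · simp only [hn, if_false]; ring
  rw [hterm] at S3
  have hval : π * (-Fe) - Δ = π ^ 2 * ((2 * π)⁻¹ * A2 - 5 * ((2 * π)⁻¹ * A1) + 4 * ((2 * π)⁻¹ * A0)
      - 4 * ‖hwC p 0‖ ^ 2) := by
    rw [hc, hFe, hΔ, hF]; field_simp; ring
  have hbig : ∀ n : ℤ, 3 ≤ |n| → (9:ℝ) ≤ (n:ℝ) ^ 2 := by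
    intro n hn
    have : 9 ≤ n ^ 2 := by rw [← sq_abs]; nlinarith
    exact_mod_cast this
  have hsmall : ∀ n : ℤ, n ≠ 0 → ¬ 3 ≤ |n| → ((n:ℝ) ^ 2 - 1) * ((n:ℝ) ^ 2 - 4) = 0 := by
    intro n hn h3
    have h4 := abs_lt.1 (not_le.1 h3)
    obtain ⟨h5, h6⟩ := h4
    interval_cases n <;> first | exact absurd rfl hn | norm_num
  have hne0 : ∀ n : ℤ, 3 ≤ |n| → n ≠ 0 := by
    intro n h hn; subst hn; norm_num at h
  have hnn : ∀ n : ℤ, 0 ≤ (if n = 0 then 0 else ((n:ℝ) ^ 2 - 1) * ((n:ℝ) ^ 2 - 4) * ‖hwC p n‖ ^ 2) := by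
    intro n
    by_cases hn : n = 0
    · simp [hn]
    · simp only [hn, if_false]
      by_cases h3 : 3 ≤ |n|
      · have := hbig n h3
        have h1 : 0 ≤ (n:ℝ) ^ 2 - 1 := by linarith
        have h2 : 0 ≤ (n:ℝ) ^ 2 - 4 := by linarith
        positivity
      · rw [hsmall n hn h3, zero_mul]
  have main : Δ = π * |Fe| ↔ ∃ a₀ a₁ b₁ a₂ b₂ : ℝ, ∀ φ : ℝ,
        p φ = a₀ + a₁ * Real.cos φ + b₁ * Real.sin φ +
          a₂ * Real.cos (2 * φ) + b₂ * Real.sin (2 * φ) := by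
    rw [abs_of_nonpos hFe0]
    constructor
    · intro h
      apply hwC_recon p hper hc0
      rw [← h, sub_self] at hval
      have hz := (mul_eq_zero.1 hval.symm).resolve_left (by positivity)
      rw [hz] at S3
      have hall := (hasSum_zero_iff_of_nonneg hnn).1 S3
      intro n hn
      have h1 := congrFun hall n
      have h9 := hbig n hn
      simp only [hne0 n hn, if_false, Pi.zero_apply] at h1
      have hp1 : ((n:ℝ) ^ 2 - 1) * ((n:ℝ) ^ 2 - 4) ≠ 0 := by
        apply mul_ne_zero <;> linarith
      simpa using (mul_eq_zero.1 h1).resolve_left hp1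
    · rintro ⟨a₀, a₁, b₁, a₂, b₂, hp⟩
      have hz := hwC_trig p a₀ a₁ b₁ a₂ b₂ hp
      have : (fun n : ℤ => if n = 0 then 0 else ((n:ℝ) ^ 2 - 1) * ((n:ℝ) ^ 2 - 4) * ‖hwC p n‖ ^ 2)
          = fun _ => 0 := by
        funext n
        by_cases hn : n = 0
        · simp [hn]
        · simp only [hn, if_false]
          by_cases h3 : 3 ≤ |n|
          · simp [hz n h3]
          · rw [hsmall n hn h3, zero_mul]
      rw [this] at S3
      rw [S3.unique hasSum_zero, mul_zero] at hval
      linarith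
  refine ⟨main, ?_⟩
  rw [← main]
  have hF2 : F - L ^ 2 / (4 * π) = - (Δ / (4 * π)) := by rw [hΔ]; field_simp; ring
  rw [hF2, abs_neg, abs_of_nonneg (by positivity : 0 ≤ Δ / (4 * π))]
  constructor
  · intro h; rw [h]; field_simp
  · intro h; rw [h]; field_simp
end
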